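/- Let n = 2m and let f1, f2, f3 be bent functions in n variables and f4 = f1 + f2 + f3, such that: (1) there is an m-dimensional subspace U of F_2^n which, for each i = 1,…,4, is the unique m-dimensional M-subspace of f_i; (2) f = f1||f2||f3||f4 is a bent function in n+2 variables. Suppose that for every v ∈ F_2^n and every (m−1)-dimensional subspace V of F_2^n that is an M-subspace of all of f1, f2, f3, f4, there exist u1, u2, u3 ∈ V such that the following three conditions hold simultaneously: (a) the function x ↦ D_{u1}f1(x) + D_{u1}f2(x+v) is not identically zero; (b) the function x ↦ D_{u2}f1(x) + D_{u2}f3(x+v) is not identically zero; (c) the function x ↦ D_{u3}f2(x) + D_{u3}f3(x+v) is not identically zero. Then f has no (m+1)-dimensional M-subspace; i.e., f is outside the completed Maiorana–McFarland class MM^#. -/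

import Mathlib

open scoped BigOperators

/-- The vector space `F_2^n`. -/
abbrev BV (n : ℕ) := Fin n → ZMod 2

/-- Dot product on `F_2^n`. -/
def dotp {n : ℕ} (x y : BV n) : ZMod 2 := ∑ i, x i * y i

/-- `W` is an M-subspace of `f` : all second-order derivatives of `f` in directions
from `W` vanish identically. -/
def IsMSub {M : Type} [AddCommGroup M] [Module (ZMod 2) M] (f : M → ZMod 2)
    (W : Submodule (ZMod 2) M) : Prop :=
  ∀ a ∈ W, ∀ b ∈ W, ∀ x, f x + f (x + a) + f (x + b) + f (x + a + b) = 0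


/-- The bent 4-concatenation `f = f1 || f2 || f3 || f4`:
`f (x, y1, y2) = f1 x + y1 (f1 x + f3 x) + y2 (f1 x + f2 x)
  + y1 y2 (f1 x + f2 x + f3 x + f4 x)`. -/
def concat {X : Type} (f1 f2 f3 f4 : X → ZMod 2) :
    X × (ZMod 2 × ZMod 2) → ZMod 2 :=
  fun p =>
    f1 p.1 + p.2.1 * (f1 p.1 + f3 p.1) + p.2.2 * (f1 p.1 + f2 p.1)
      + p.2.1 * p.2.2 * (f1 p.1 + f2 p.1 + f3 p.1 + f4 p.1)

/-- Walsh–Hadamard transform of `f : F_2^n → F_2` at `a`. -/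
def walsh {n : ℕ} (f : BV n → ZMod 2) (a : BV n) : ℤ :=
  ∑ x : BV n, (-1 : ℤ) ^ (f x + dotp a x).val

/-- Walsh–Hadamard transform of a function on `F_2^n × F_2 × F_2` at `a`. -/
def walshC {n : ℕ} (f : BV n × (ZMod 2 × ZMod 2) → ZMod 2)
    (a : BV n × (ZMod 2 × ZMod 2)) : ℤ :=
  ∑ p : BV n × (ZMod 2 × ZMod 2),
    (-1 : ℤ) ^ (f p + dotp a.1 p.1 + a.2.1 * p.2.1 + a.2.2 * p.2.2).val

open Module

/-- Between two subspaces there are subspaces of every intermediate dimension. -/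
theorem Submodule.exists_finrank_eq_between {K E : Type*} [DivisionRing K] [AddCommGroup E]
    [Module K E] [Module.Finite K E] {P S : Submodule K E} (hPS : P ≤ S) {d : ℕ}
    (hd : finrank K P ≤ d) (hdS : d ≤ finrank K S) :
    ∃ A : Submodule K E, P ≤ A ∧ A ≤ S ∧ finrank K A = d := by
  induction d, hd using Nat.le_induction with
  | base => exact ⟨P, le_rfl, hPS, rfl⟩
  | succ k hk ih =>
    obtain ⟨A, hPA, hAS, hA⟩ := ih (by omega)
    obtain ⟨x, hxS, hxA⟩ : ∃ x ∈ S, x ∉ A := by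
      by_contra! h
      have := Submodule.finrank_mono (R := K) (show S ≤ A from h)
      omega
    refine ⟨A ⊔ K ∙ x, hPA.trans le_sup_left, sup_le hAS ?_, ?_⟩
    · rwa [Submodule.span_singleton_le_iff_mem]
    · rw [Submodule.finrank_sup_span_singleton hxA, hA]

theorem Submodule.finrank_comap_of_injective {K E F : Type*} [DivisionRing K] [AddCommGroup E]
    [Module K E] [AddCommGroup F] [Module K F] {f : E →ₗ[K] F} (hf : Function.Injective f)
    (S : Submodule K F) :
    finrank K (S.comap f) = finrank K ↥(f.range ⊓ S) := by
  rw [← Submodule.map_comap_eq]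
  exact ((S.comap f).equivMapOfInjective f hf).finrank_eq

/-- A subspace `S` of `E × F` loses at most `finrank F` dimensions when intersected with `E`. -/
theorem Submodule.finrank_le_finrank_comap_inl_add {K E F : Type*} [DivisionRing K]
    [AddCommGroup E] [Module K E] [Module.Finite K E] [AddCommGroup F] [Module K F]
    [Module.Finite K F] (S : Submodule K (E × F)) :
    finrank K S ≤ finrank K (S.comap (LinearMap.inl K E F)) + finrank K F := by
  have h := Submodule.finrank_sup_add_finrank_inf_eq (LinearMap.inl K E F).range S
  have hsup := Submodule.finrank_le ((LinearMap.inl K E F).range ⊔ S)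
  rw [finrank_prod] at hsup
  rw [LinearMap.finrank_range_of_inj LinearMap.inl_injective] at h
  rw [Submodule.finrank_comap_of_injective LinearMap.inl_injective]
  omega

/-- The restriction of `concat f1 f2 f3 f4` to each slice. -/
theorem concat_eq {X : Type} (f1 f2 f3 f4 : X → ZMod 2) (x : X) :
    concat f1 f2 f3 f4 (x, 0, 0) = f1 x ∧ concat f1 f2 f3 f4 (x, 0, 1) = f2 x ∧
      concat f1 f2 f3 f4 (x, 1, 0) = f3 x ∧ concat f1 f2 f3 f4 (x, 1, 1) = f4 x := by
  simp only [concat]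
  generalize f1 x = a, f2 x = b, f3 x = c, f4 x = d
  revert a b c d
  decide

theorem IsMSub.mono {M : Type} [AddCommGroup M] [Module (ZMod 2) M] {f : M → ZMod 2}
    {V W : Submodule (ZMod 2) M} (hW : IsMSub f W) (hVW : V ≤ W) : IsMSub f V :=
  fun a ha b hb => hW a (hVW ha) b (hVW hb)

/-- An M-subspace of a concatenation restricts to a common M-subspace of its components. -/
theorem IsMSub.comap_inl_concat {M : Type} [AddCommGroup M] [Module (ZMod 2) M]
    {f1 f2 f3 f4 : M → ZMod 2} {W : Submodule (ZMod 2) (M × (ZMod 2 × ZMod 2))}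
    (hW : IsMSub (concat f1 f2 f3 f4) W) :
    IsMSub f1 (W.comap (LinearMap.inl _ _ _)) ∧ IsMSub f2 (W.comap (LinearMap.inl _ _ _)) ∧
      IsMSub f3 (W.comap (LinearMap.inl _ _ _)) ∧ IsMSub f4 (W.comap (LinearMap.inl _ _ _)) := by
  have key (y : ZMod 2 × ZMod 2) :
      IsMSub (fun x => concat f1 f2 f3 f4 (x, y)) (W.comap (LinearMap.inl _ _ _)) := by
    intro a ha b hb x
    simpa using hW _ ha _ hb (x, y)
  have e := concat_eq f1 f2 f3 f4
  refine ⟨?_, ?_, ?_, ?_⟩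
  · simpa only [(e _).1] using key (0, 0)
  · simpa only [(e _).2.1] using key (0, 1)
  · simpa only [(e _).2.2.1] using key (1, 0)
  · simpa only [(e _).2.2.2] using key (1, 1)

/-- If an M-subspace of a concatenation contains a vector `(v, c)` with `c ≠ 0`, then two of the
first three components have, up to the shift `v`, the same derivatives along its horizontal part. -/
theorem IsMSub.derivative_eq_of_mem_concat {M : Type} [AddCommGroup M] [Module (ZMod 2) M]
    {f1 f2 f3 f4 : M → ZMod 2} {W : Submodule (ZMod 2) (M × (ZMod 2 × ZMod 2))}
    (hW : IsMSub (concat f1 f2 f3 f4) W) {v : M} {c : ZMod 2 × ZMod 2} (hv : (v, c) ∈ W)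
    (hc : c ≠ 0) :
    (∀ u ∈ W.comap (LinearMap.inl _ _ _), ∀ x,
      (f1 (x + u) + f1 x) + (f2 (x + v + u) + f2 (x + v)) = 0) ∨
    (∀ u ∈ W.comap (LinearMap.inl _ _ _), ∀ x,
      (f1 (x + u) + f1 x) + (f3 (x + v + u) + f3 (x + v)) = 0) ∨
    (∀ u ∈ W.comap (LinearMap.inl _ _ _), ∀ x,
      (f2 (x + u) + f2 x) + (f3 (x + v + u) + f3 (x + v)) = 0) := by
  have e := concat_eq f1 f2 f3 f4
  have key (y : ZMod 2 × ZMod 2) (u : M) (hu : u ∈ W.comap (LinearMap.inl _ _ _)) (x : M) :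
      (concat f1 f2 f3 f4 (x + u, y) + concat f1 f2 f3 f4 (x, y)) +
        (concat f1 f2 f3 f4 (x + v + u, y + c) + concat f1 f2 f3 f4 (x + v, y + c)) = 0 := by
    have h := hW _ hu _ hv (x, y)
    simp only [LinearMap.inl_apply, Prod.mk_add_mk, add_zero] at h
    rw [add_right_comm x v u, ← h]
    ring
  have hcases : c = (0, 1) ∨ c = (1, 0) ∨ c = (1, 1) := by
    clear key hv; decide +revert
  have h10 : ((0, 1) + (1, 1) : ZMod 2 × ZMod 2) = (1, 0) := by decide
  rcases hcases with rfl | rfl | rfl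
  · exact .inl fun u hu x => by
      simpa only [Prod.mk_add_mk, zero_add, (e _).1, (e _).2.1] using key (0, 0) u hu x
  · exact .inr <| .inl fun u hu x => by
      simpa only [Prod.mk_add_mk, zero_add, (e _).1, (e _).2.2.1] using key (0, 0) u hu x
  · exact .inr <| .inr fun u hu x => by
      simpa only [h10, (e _).2.1, (e _).2.2.1] using key (0, 1) u hu x

theorem stmt17 {n m : ℕ} (hnm : n = 2 * m)
    (f1 f2 f3 f4 : BV n → ZMod 2)
    (hf4 : ∀ x, f4 x = f1 x + f2 x + f3 x)
    (hb1 : ∀ a, walsh f1 a = 2 ^ m ∨ walsh f1 a = -(2 ^ m))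
    (hb2 : ∀ a, walsh f2 a = 2 ^ m ∨ walsh f2 a = -(2 ^ m))
    (hb3 : ∀ a, walsh f3 a = 2 ^ m ∨ walsh f3 a = -(2 ^ m))
    (U : Submodule (ZMod 2) (BV n)) (hUdim : Module.finrank (ZMod 2) ↥U = m)
    (hU1 : IsMSub f1 U ∧ ∀ W : Submodule (ZMod 2) (BV n),
      Module.finrank (ZMod 2) ↥W = m → IsMSub f1 W → W = U)
    (hU2 : IsMSub f2 U ∧ ∀ W : Submodule (ZMod 2) (BV n),
      Module.finrank (ZMod 2) ↥W = m → IsMSub f2 W → W = U)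
    (hU3 : IsMSub f3 U ∧ ∀ W : Submodule (ZMod 2) (BV n),
      Module.finrank (ZMod 2) ↥W = m → IsMSub f3 W → W = U)
    (hU4 : IsMSub f4 U ∧ ∀ W : Submodule (ZMod 2) (BV n),
      Module.finrank (ZMod 2) ↥W = m → IsMSub f4 W → W = U)
    (hbent : ∀ a, walshC (concat f1 f2 f3 f4) a = 2 ^ (m + 1) ∨
      walshC (concat f1 f2 f3 f4) a = -(2 ^ (m + 1)))
    (hcond : ∀ v : BV n, ∀ V : Submodule (ZMod 2) (BV n),
      Module.finrank (ZMod 2) ↥V = m - 1 →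
      IsMSub f1 V → IsMSub f2 V → IsMSub f3 V → IsMSub f4 V →
      ∃ u1 ∈ V, ∃ u2 ∈ V, ∃ u3 ∈ V,
        (¬ ∀ x, (f1 (x + u1) + f1 x) + (f2 (x + v + u1) + f2 (x + v)) = 0) ∧
        (¬ ∀ x, (f1 (x + u2) + f1 x) + (f3 (x + v + u2) + f3 (x + v)) = 0) ∧
        (¬ ∀ x, (f2 (x + u3) + f2 x) + (f3 (x + v + u3) + f3 (x + v)) = 0)) :
    ¬ ∃ W : Submodule (ZMod 2) (BV n × (ZMod 2 × ZMod 2)),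
      Module.finrank (ZMod 2) ↥W = m + 1 ∧ IsMSub (concat f1 f2 f3 f4) W := by
  
  rintro ⟨W, hWdim, hW⟩
  set S := W.comap (LinearMap.inl (ZMod 2) (BV n) (ZMod 2 × ZMod 2)) with hS
  obtain ⟨hS1, hS2, hS3, hS4⟩ := hW.comap_inl_concat
  by_cases hvert : ∃ w ∈ W, w.2 ≠ 0
  · obtain ⟨⟨v, c⟩, hv, hc⟩ := hvert
    have hSdim := Submodule.finrank_le_finrank_comap_inl_add W
    rw [hWdim, finrank_prod, finrank_self, ← hS] at hSdim
    obtain ⟨V, -, hVS, hV⟩ := Submodule.exists_finrank_eq_between (bot_le (a := S))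
      (d := m - 1) (by simp) (by omega)
    obtain ⟨u1, hu1, u2, hu2, u3, hu3, h12, h13, h23⟩ := hcond v V hV
      (hS1.mono hVS) (hS2.mono hVS) (hS3.mono hVS) (hS4.mono hVS)
    rcases hW.derivative_eq_of_mem_concat hv hc with h | h | h
    · exact h12 (h u1 (hVS hu1))
    · exact h13 (h u2 (hVS hu2))
    · exact h23 (h u3 (hVS hu3))
  · push Not at hvert
    have hSdim : finrank (ZMod 2) S = m + 1 := by
      rw [hS, Submodule.finrank_comap_of_injective LinearMap.inl_injective, ← hWdim,
        inf_eq_right.2]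
      exact fun w hw => ⟨w.1, Prod.ext rfl (hvert w hw).symm⟩
    obtain ⟨x, hxS, hxU⟩ : ∃ x ∈ S, x ∉ U := by
      by_contra! h
      have := Submodule.finrank_mono (R := ZMod 2) (show S ≤ U from h)
      omega
    have hm : m + 1 ≤ n := by
      simpa [hSdim] using Submodule.finrank_le S
    have hspan := finrank_span_singleton (K := ZMod 2) (v := x) (by rintro rfl; exact hxU U.zero_mem)
    obtain ⟨A, hxA, hAS, hA⟩ := Submodule.exists_finrank_eq_between
      ((Submodule.span_singleton_le_iff_mem x S).2 hxS) (d := m) (by omega) (by omega)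
    exact hxU (hU1.2 A hA (hS1.mono hAS) ▸ (Submodule.span_singleton_le_iff_mem x A).1 hxA)
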